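/- arXiv:2509.18977 — 2 statements merged into one kernel-verified Lean document; each statement's English description precedes it below -/
import Mathlib

section
/- For any two normal n×n complex matrices A and B with eigenvalues (λⱼ) and (μⱼ) listed with multiplicity, the number trace(AB) lies in the convex hull of the n! points ∑_{j=1}^n λⱼ μ_{σ(j)} as σ ranges over all permutations of {1,...,n}. -/
open Matrix in
/-- Spectral theorem: a normal complex matrix is unitarily diagonalizable. -/
theorem Matrix.exists_unitary_diagonal_of_normal {n : ℕ} (A : Matrix (Fin n) (Fin n) ℂ)
    (hA : A * A.conjTranspose = A.conjTranspose * A) :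
    ∃ U ∈ unitaryGroup (Fin n) ℂ, ∃ d : Fin n → ℂ, A = U * diagonal d * star U := by
  set H : Matrix (Fin n) (Fin n) ℂ := A + Aᴴ with hH
  set K : Matrix (Fin n) (Fin n) ℂ := Complex.I • (A - Aᴴ) with hK
  have hHs : (toEuclideanLin H).IsSymmetric := by
    rw [isSymmetric_toEuclideanLin_iff]
    simp [IsHermitian, hH, add_comm]
  have hKs : (toEuclideanLin K).IsSymmetric := by
    rw [isSymmetric_toEuclideanLin_iff]
    simp [IsHermitian, hK, smul_sub, neg_add_eq_sub]
  have hHK : H * K = K * H := by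
    simp only [hH, hK, mul_smul_comm, smul_mul_assoc]
    congr 1
    simp only [add_mul, mul_add, sub_mul, mul_sub, hA]
    abel
  have hcomm : Commute (toEuclideanLin H) (toEuclideanLin K) := by
    apply LinearMap.ext
    intro x
    simp [toLpLin_apply, hHK]
  have hV₀ := hHs.directSum_isInternal_of_commute hKs hcomm
  have hV := DirectSum.isInternal_ne_bot_iff.mpr hV₀
  have : Fintype {i : ℂ × ℂ // Module.End.eigenspace (toEuclideanLin H) i.2 ⊓
      Module.End.eigenspace (toEuclideanLin K) i.1 ≠ ⊥} :=
    (WellFoundedGT.finite_ne_bot_of_iSupIndep hV₀.submodule_iSupIndep).fintype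
  have hV' := (hHs.orthogonalFamily_eigenspace_inf_eigenspace hKs).comp
    (Subtype.val_injective (p := fun i : ℂ × ℂ => Module.End.eigenspace (toEuclideanLin H) i.2 ⊓
      Module.End.eigenspace (toEuclideanLin K) i.1 ≠ ⊥))
  have hn : Module.finrank ℂ (EuclideanSpace ℂ (Fin n)) = n := by simp
  set b := hV.subordinateOrthonormalBasis hn hV'
  set ix : Fin n → ℂ × ℂ := fun j => (hV.subordinateOrthonormalBasisIndex hn j hV').1
  have hmem : ∀ j, toEuclideanLin H (b j) = (ix j).2 • b j ∧
      toEuclideanLin K (b j) = (ix j).1 • b j := fun j => by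
    have := hV.subordinateOrthonormalBasis_subordinate hn j hV'
    rw [Submodule.mem_inf, Module.End.mem_eigenspace_iff, Module.End.mem_eigenspace_iff] at this
    exact this
  set d : Fin n → ℂ := fun j => (1 / 2) * ((ix j).2 - Complex.I * (ix j).1) with hd
  set U := (EuclideanSpace.basisFun (Fin n) ℂ).toBasis.toMatrix b with hUdef
  have hU : U ∈ unitaryGroup (Fin n) ℂ :=
    OrthonormalBasis.toMatrix_orthonormalBasis_mem_unitary _ _
  have hUij : ∀ i j, U i j = b j i := fun i j => by
    simp [hUdef, Module.Basis.toMatrix_apply]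
  have hAHK : A = (1 / 2 : ℂ) • (H - Complex.I • K) := by
    rw [hH, hK, smul_smul, Complex.I_mul_I]
    ext i j
    simp
    ring
  have hAU : A * U = U * diagonal d := by
    ext i j
    have h1 : (H * U) i j = (ix j).2 * U i j := by
      have := congrArg (fun v : EuclideanSpace ℂ (Fin n) => v i) (hmem j).1
      simpa [toLpLin_apply, mulVec, dotProduct, mul_apply, hUij] using this
    have h2 : (K * U) i j = (ix j).1 * U i j := by
      have := congrArg (fun v : EuclideanSpace ℂ (Fin n) => v i) (hmem j).2
      simpa [toLpLin_apply, mulVec, dotProduct, mul_apply, hUij] using this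
    rw [hAHK, smul_mul_assoc, sub_mul, smul_mul_assoc, mul_diagonal]
    simp only [smul_apply, sub_apply, h1, h2, smul_eq_mul, hd]
    ring
  refine ⟨U, hU, d, ?_⟩
  rw [← hAU, mul_assoc, mem_unitaryGroup_iff.mp hU, mul_one]

/-- Two finite families with the same monic polynomial of roots agree up to a permutation. -/
theorem Polynomial.exists_perm_of_prod_X_sub_C_eq {R ι : Type*} [CommRing R] [IsDomain R]
    [Fintype ι] {f g : ι → R} (h : ∏ j, (X - C (f j)) = ∏ j, (X - C (g j))) :
    ∃ σ : Equiv.Perm ι, ∀ j, f j = g (σ j) := by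
  classical
  have hms : Finset.univ.val.map f = Finset.univ.val.map g := by
    have hroots : ∀ k : ι → R, (∏ j, (X - C (k j))).roots = Finset.univ.val.map k := fun k => by
      rw [← Polynomial.roots_multiset_prod_X_sub_C (Finset.univ.val.map k), Multiset.map_map]
      rfl
    rw [← hroots f, h, hroots g]
  have hcard : ∀ c, Fintype.card {j // f j = c} = Fintype.card {j // g j = c} := fun c => by
    have := congrArg (Multiset.count c) hms
    simp only [Multiset.count_map] at this
    rw [Fintype.card_subtype, Fintype.card_subtype]
    simpa [Finset.card_def, eq_comm] using this
  exact ⟨Equiv.ofFiberEquiv fun c => Fintype.equivOfCardEq (hcard c),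
    fun j => (Equiv.ofFiberEquiv_map _ j).symm⟩

open Matrix in
/-- The squared moduli of the entries of a unitary matrix form a doubly stochastic matrix. -/
theorem Matrix.normSq_mem_doublyStochastic {ι : Type*} [Fintype ι] [DecidableEq ι]
    {W : Matrix ι ι ℂ} (hW : W ∈ unitaryGroup ι ℂ) :
    (of fun i j => Complex.normSq (W i j)) ∈ doublyStochastic ℝ ι := by
  rw [mem_doublyStochastic_iff_sum]
  refine ⟨fun i j => Complex.normSq_nonneg _, fun i => ?_, fun j => ?_⟩
  · have := congrFun₂ (mem_unitaryGroup_iff.mp hW) i i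
    simp only [mul_apply, star_apply, one_apply_eq, Complex.star_def, Complex.mul_conj] at this
    exact_mod_cast this
  · have := congrFun₂ (mem_unitaryGroup_iff'.mp hW) j j
    simp only [mul_apply, star_apply, one_apply_eq, Complex.star_def,
      ← Complex.normSq_eq_conj_mul_self] at this
    exact_mod_cast this

open Matrix in
/-- A bilinear form weighted by a doubly stochastic matrix is a convex combination of its values
along permutations. -/
theorem Matrix.sum_mul_mem_convexHull_of_mem_doublyStochastic {ι : Type*} [Fintype ι]
    [DecidableEq ι] {M : Matrix ι ι ℝ} (hM : M ∈ doublyStochastic ℝ ι) (d e : ι → ℂ) :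
    ∑ i, ∑ j, (M i j : ℂ) * (d i * e j) ∈ convexHull ℝ
      {z : ℂ | ∃ σ : Equiv.Perm ι, z = ∑ j, d j * e (σ j)} := by
  obtain ⟨w, hw0, hw1, rfl⟩ := exists_eq_sum_perm_of_mem_doublyStochastic hM
  refine mem_convexHull_of_exists_fintype w (fun σ => ∑ j, d j * e (σ j)) hw0 hw1
    (fun σ => ⟨σ, rfl⟩) ?_
  simp only [sum_apply, smul_apply, Complex.ofReal_sum, Finset.sum_mul]
  rw [Finset.sum_congr rfl fun i _ => Finset.sum_comm, Finset.sum_comm]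
  refine Finset.sum_congr rfl fun σ _ => ?_
  rw [Finset.smul_sum]
  refine Finset.sum_congr rfl fun i _ => ?_
  rw [Finset.sum_eq_single (σ i)]
  · simp [Equiv.toPEquiv_apply, PEquiv.toMatrix_apply]
  · intro j _ hj
    simp [Equiv.toPEquiv_apply, PEquiv.toMatrix_apply, hj.symm]
  · simp

open Matrix in
theorem Matrix.trace_diagonal_mul_conj_diagonal {ι : Type*} [Fintype ι] [DecidableEq ι]
    (W : Matrix ι ι ℂ) (d e : ι → ℂ) :
    (diagonal d * (W * diagonal e * star W)).trace =
      ∑ i, ∑ j, (Complex.normSq (W i j) : ℂ) * (d i * e j) := by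
  refine Finset.sum_congr rfl fun i _ => ?_
  rw [diag_apply, diagonal_mul, mul_apply, Finset.mul_sum]
  refine Finset.sum_congr rfl fun j _ => ?_
  rw [mul_diagonal, star_apply, Complex.star_def, ← Complex.mul_conj]
  ring

open Matrix in
theorem Matrix.charpoly_unitary_conj_diagonal {ι : Type*} [Fintype ι] [DecidableEq ι]
    {U : Matrix ι ι ℂ} (hU : U ∈ unitaryGroup ι ℂ) (d : ι → ℂ) :
    (U * diagonal d * star U).charpoly = ∏ j, (Polynomial.X - Polynomial.C (d j)) := by
  rw [charpoly_mul_comm, ← mul_assoc, mem_unitaryGroup_iff'.mp hU, one_mul, charpoly_diagonal]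

/-- Von Neumann's trace inequality for normal matrices: trace (A*B) lies in the convex
hull of the points `∑ j, λ j * μ (σ j)` over permutations σ. -/
theorem trace_mem_convexHull_of_normal {n : ℕ} (A B : Matrix (Fin n) (Fin n) ℂ)
    (hA : A * A.conjTranspose = A.conjTranspose * A)
    (hB : B * B.conjTranspose = B.conjTranspose * B)
    (lam mu : Fin n → ℂ)
    (hlam : A.charpoly = ∏ j, (Polynomial.X - Polynomial.C (lam j)))
    (hmu : B.charpoly = ∏ j, (Polynomial.X - Polynomial.C (mu j))) :
    (A * B).trace ∈ convexHull ℝ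
      {z : ℂ | ∃ σ : Equiv.Perm (Fin n), z = ∑ j, lam j * mu (σ j)} := by
  obtain ⟨U, hU, d, rfl⟩ := Matrix.exists_unitary_diagonal_of_normal A hA
  obtain ⟨V, hV, e, rfl⟩ := Matrix.exists_unitary_diagonal_of_normal B hB
  rw [Matrix.charpoly_unitary_conj_diagonal hU] at hlam
  rw [Matrix.charpoly_unitary_conj_diagonal hV] at hmu
  obtain ⟨α, hα⟩ := Polynomial.exists_perm_of_prod_X_sub_C_eq hlam
  obtain ⟨β, hβ⟩ := Polynomial.exists_perm_of_prod_X_sub_C_eq hmu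
  have hW : star U * V ∈ Matrix.unitaryGroup (Fin n) ℂ := mul_mem (Unitary.star_mem hU) hV
  have htrace : (U * Matrix.diagonal d * star U * (V * Matrix.diagonal e * star V)).trace =
      (Matrix.diagonal d *
        ((star U * V) * Matrix.diagonal e * star (star U * V))).trace := by
    rw [mul_assoc, mul_assoc U, Matrix.trace_mul_comm U]
    simp only [star_mul, star_star, mul_assoc]
  rw [htrace, Matrix.trace_diagonal_mul_conj_diagonal]
  refine convexHull_mono ?_ (Matrix.sum_mul_mem_convexHull_of_mem_doublyStochastic
    (Matrix.normSq_mem_doublyStochastic hW) d e)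
  rintro z ⟨σ, rfl⟩
  refine ⟨α.symm.trans (σ.trans β), ?_⟩
  rw [← Equiv.sum_comp α fun j => lam j * mu (α.symm.trans (σ.trans β) j)]
  simp [hα, hβ]
end

section
/- Let D be an N×N symmetric real matrix (a symmetric TSP distance matrix) with zero diagonal, N ≥ 3. Define L_min(D) = min over permutations σ of Fin N of ∑_{j} D_{σ(j), σ(j+1)} (indices cyclic). Let μ₁ ≥ ... ≥ μ_{N−1} be the eigenvalues of −P D P restricted to the hyperplane orthogonal to the all-ones vector, where P = I − (1/N)J, and let c₁ ≤ ... ≤ c_{N−1} be the numbers {1 − cos(2πk/N)}_{k=1}^{N−1} sorted increasingly (with multiplicity). Then L_min(D) ≥ ∑_{k=1}^{N−1} cₖ μₖ. -/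
open Finset Matrix Polynomial

/-- Two families indexed by a finite type with the same multiset of values differ by a
permutation of the index type. -/
theorem exists_perm_eq_of_map_univ_eq {ι α : Type*} [Fintype ι] {f g : ι → α}
    (h : (univ : Finset ι).val.map f = (univ : Finset ι).val.map g) :
    ∃ τ : Equiv.Perm ι, ∀ i, f i = g (τ i) := by
  classical
  have key : ∀ a, Nonempty ({i // f i = a} ≃ {i // g i = a}) := by
    intro a
    refine Fintype.card_eq.1 ?_
    have := congrArg (Multiset.count a) h
    rw [Multiset.count_map, Multiset.count_map] at this
    rw [Fintype.card_subtype, Fintype.card_subtype]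
    simpa only [eq_comm, Finset.card_def, Finset.filter_val] using this
  exact ⟨Equiv.ofFiberEquiv fun a => (key a).some, fun i => (Equiv.ofFiberEquiv_map _ i).symm⟩

/-- Averaging an antivarying pair of families over a doubly stochastic matrix can only increase
the sum of products. -/
theorem Antivary.sum_mul_le_sum_doublyStochastic {ι : Type*} [Fintype ι] [DecidableEq ι]
    {c μ : ι → ℝ} (h : Antivary c μ) {W : Matrix ι ι ℝ} (hW : W ∈ doublyStochastic ℝ ι) :
    ∑ k, c k * μ k ≤ ∑ i, ∑ k, c i * (W i k * μ k) := by
  obtain ⟨w, hw0, hw1, rfl⟩ := exists_eq_sum_perm_of_mem_doublyStochastic hW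
  have hterm : ∀ i, ∑ k, c i * ((∑ σ : Equiv.Perm ι, w σ • σ.permMatrix ℝ) i k * μ k) =
      ∑ σ : Equiv.Perm ι, w σ * (c i * μ (σ i)) := by
    intro i
    simp only [Matrix.sum_apply, Finset.sum_mul, Finset.mul_sum]
    rw [Finset.sum_comm]
    refine sum_congr rfl fun σ _ => ?_
    rw [Finset.sum_eq_single (σ i)]
    · simp [Equiv.Perm.permMatrix, PEquiv.toMatrix_apply]
      ring
    · intro b _ hb
      simp [Equiv.Perm.permMatrix, PEquiv.toMatrix_apply, hb.symm]
    · simp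
  calc ∑ k, c k * μ k = ∑ σ : Equiv.Perm ι, w σ * ∑ k, c k * μ k := by
        rw [← Finset.sum_mul, hw1, one_mul]
    _ ≤ ∑ σ : Equiv.Perm ι, w σ * ∑ i, c i * μ (σ i) :=
        sum_le_sum fun σ _ => mul_le_mul_of_nonneg_left h.sum_mul_le_sum_mul_comp_perm (hw0 σ)
    _ = _ := by
        simp only [hterm, Finset.mul_sum]
        rw [Finset.sum_comm]

/-- A weak form of Schur's majorization theorem: pairing the diagonal of a Hermitian matrix with
weights `c` gives at least the oppositely ordered pairing of the weights with the eigenvalues. -/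
theorem Matrix.IsHermitian.sum_mul_le_sum_mul_diag {ι : Type*} [Fintype ι] [DecidableEq ι]
    {A : Matrix ι ι ℂ} (hA : A.IsHermitian) {c μ : ι → ℝ} (h : Antivary c μ)
    (hμ : A.charpoly = ∏ j, (X - C (μ j : ℂ))) (g : Equiv.Perm ι) :
    ∑ k, c k * μ k ≤ ∑ k, c k * (A (g k) (g k)).re := by
  have hroots : (univ : Finset ι).val.map μ = (univ : Finset ι).val.map hA.eigenvalues := by
    have h1 := hA.roots_charpoly_eq_eigenvalues
    have h2 : A.charpoly.roots = (univ : Finset ι).val.map (fun j => (μ j : ℂ)) := by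
      rw [hμ, Polynomial.roots_prod _ _
        (by simp [Finset.prod_ne_zero_iff, Polynomial.X_sub_C_ne_zero])]
      simp
    have := congrArg (Multiset.map Complex.re) (h2.symm.trans h1)
    simpa [Multiset.map_map, Function.comp_def] using this
  obtain ⟨τ, hτ⟩ := exists_perm_eq_of_map_univ_eq hroots
  have hU := hA.eigenvectorUnitary.2
  rw [Matrix.mem_unitaryGroup_iff] at hU
  have hU' := hA.eigenvectorUnitary.2
  rw [Matrix.mem_unitaryGroup_iff'] at hU'
  set U : Matrix ι ι ℂ := (hA.eigenvectorUnitary : Matrix ι ι ℂ) with hUdef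
  have hdiag : ∀ i, (A i i).re = ∑ k, Complex.normSq (U i k) * hA.eigenvalues k := by
    intro i
    conv_lhs => rw [hA.spectral_theorem, Unitary.conjStarAlgAut_apply, ← hUdef]
    rw [Matrix.mul_apply, Complex.re_sum]
    refine sum_congr rfl fun k _ => ?_
    rw [Matrix.mul_diagonal, star_apply, mul_right_comm, Complex.star_def, Complex.mul_conj]
    simp
  have hrow : ∀ i, ∑ k, Complex.normSq (U i k) = 1 := by
    intro i
    have := congrFun (congrFun hU i) i
    simp only [Matrix.mul_apply, star_apply, Complex.star_def, Complex.mul_conj,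
      Matrix.one_apply_eq] at this
    exact_mod_cast this
  have hcol : ∀ k, ∑ i, Complex.normSq (U i k) = 1 := by
    intro k
    have := congrFun (congrFun hU' k) k
    simp only [Matrix.mul_apply, star_apply, Complex.star_def, mul_comm _ (U _ _),
      Complex.mul_conj, Matrix.one_apply_eq] at this
    exact_mod_cast this
  have hW : (Matrix.of fun i k => Complex.normSq (U (g i) (τ k))) ∈ doublyStochastic ℝ ι := by
    rw [mem_doublyStochastic_iff_sum]
    refine ⟨fun i j => Complex.normSq_nonneg _, fun i => ?_, fun j => ?_⟩
    · simpa using (Equiv.sum_comp τ fun k => Complex.normSq (U (g i) k)).trans (hrow _)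
    · simpa using (Equiv.sum_comp g fun i => Complex.normSq (U i (τ j))).trans (hcol _)
  refine (h.sum_mul_le_sum_doublyStochastic hW).trans_eq (sum_congr rfl fun i _ => ?_)
  rw [hdiag, ← Finset.mul_sum]
  congr 1
  simp only [of_apply, hτ]
  exact Equiv.sum_comp τ fun k => Complex.normSq (U (g i) k) * hA.eigenvalues k

/-- The sum of the nontrivial powers of an `N`-th root of unity. -/
theorem sum_pow_succ_of_pow_eq_one {N : ℕ} (hN : N ≠ 0) {z : ℂ} (hz : z ^ N = 1) :
    ∑ k : Fin (N - 1), z ^ ((k : ℕ) + 1) = (if z = 1 then (N : ℂ) else 0) - 1 := by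
  obtain ⟨n, rfl⟩ := Nat.exists_eq_succ_of_ne_zero hN
  have h1 : ∑ k ∈ range (n + 1), z ^ k = if z = 1 then ((n + 1 : ℕ) : ℂ) else 0 := by
    split_ifs with h
    · simp [h]
    · rw [geom_sum_eq h, hz, sub_self, zero_div]
  rw [Finset.sum_range_succ'] at h1
  rw [← h1]
  simp [Finset.sum_range]

/-- The nontrivial columns of the discrete Fourier matrix attached to a root of unity `ζ`. -/
noncomputable def fourierColumns (N : ℕ) (ζ : ℂ) : Matrix (Fin N) (Fin (N - 1)) ℂ :=
  Matrix.of fun j k => (Real.sqrt N : ℂ)⁻¹ * (ζ ^ (j : ℕ)) ^ ((k : ℕ) + 1)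

theorem fourierColumns_mul_diagonal_mul_apply {N : ℕ} {ζ : ℂ}
    (hζ : ‖ζ‖ = 1) (d : Fin (N - 1) → ℂ) (i j : Fin N) :
    (fourierColumns N ζ * diagonal d * (fourierColumns N ζ)ᴴ) i j =
      (N : ℂ)⁻¹ * ∑ k, d k * (ζ ^ (i : ℕ) * (ζ ^ (j : ℕ))⁻¹) ^ ((k : ℕ) + 1) := by
  have hs : (Real.sqrt N : ℂ)⁻¹ * (Real.sqrt N : ℂ)⁻¹ = (N : ℂ)⁻¹ := by
    rw [← mul_inv, ← Complex.ofReal_mul, Real.mul_self_sqrt (Nat.cast_nonneg N)]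
    simp
  rw [Matrix.mul_apply, Finset.mul_sum]
  refine sum_congr rfl fun k _ => ?_
  rw [Matrix.mul_diagonal, conjTranspose_apply, ← hs]
  simp only [fourierColumns, of_apply, Complex.star_def, map_mul, map_pow, map_inv₀,
    Complex.conj_ofReal, ← Complex.inv_eq_conj hζ]
  rw [mul_pow, inv_pow]
  ring

theorem IsPrimitiveRoot.pow_mul_inv_pow_eq_one_iff {N : ℕ} {ζ : ℂ} (h : IsPrimitiveRoot ζ N)
    (i j : Fin N) : ζ ^ (i : ℕ) * (ζ ^ (j : ℕ))⁻¹ = 1 ↔ i = j := by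
  have hζ0 : ζ ≠ 0 := h.ne_zero (i.pos.ne')
  rw [mul_inv_eq_one₀ (pow_ne_zero _ hζ0)]
  exact ⟨fun H => Fin.ext (h.pow_inj i.2 j.2 H), fun H => by rw [H]⟩

theorem fourierColumns_mul_conjTranspose {N : ℕ} [NeZero N] {ζ : ℂ} (h : IsPrimitiveRoot ζ N) :
    fourierColumns N ζ * (fourierColumns N ζ)ᴴ =
      1 - (N : ℂ)⁻¹ • Matrix.of (fun _ _ => (1 : ℂ)) := by
  ext i j
  have hζ := h.norm'_eq_one (NeZero.ne N)
  have hN : (N : ℂ) ≠ 0 := NeZero.ne _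
  have := fourierColumns_mul_diagonal_mul_apply hζ (fun _ => 1) i j
  rw [show diagonal (fun _ : Fin (N - 1) => (1 : ℂ)) = 1 from diagonal_one, Matrix.mul_one] at this
  rw [this]
  simp only [one_mul]
  rw [sum_pow_succ_of_pow_eq_one (NeZero.ne N), Matrix.sub_apply, Matrix.one_apply]
  · simp only [h.pow_mul_inv_pow_eq_one_iff, Matrix.smul_apply, of_apply, smul_eq_mul, mul_one]
    split_ifs
    · field_simp
    · simp
  · rw [mul_pow, inv_pow, ← pow_mul, ← pow_mul, mul_comm (i : ℕ), mul_comm (j : ℕ), pow_mul,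
      pow_mul, h.pow_eq_one]
    simp

theorem sum_fourierColumns {N : ℕ} {ζ : ℂ} (h : IsPrimitiveRoot ζ N) (k : Fin (N - 1)) :
    ∑ j, fourierColumns N ζ j k = 0 := by
  have hne : ζ ^ ((k : ℕ) + 1) ≠ 1 := h.pow_ne_one_of_pos_of_lt (by omega) (by omega)
  have hpow : (ζ ^ ((k : ℕ) + 1)) ^ N = 1 := by
    rw [← pow_mul, mul_comm, pow_mul, h.pow_eq_one, one_pow]
  simp only [fourierColumns, of_apply]
  rw [← Finset.mul_sum]
  simp only [← pow_mul, mul_comm _ ((k : ℕ) + 1)]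
  simp only [pow_mul]
  rw [Fin.sum_univ_eq_sum_range (fun j => (ζ ^ ((k : ℕ) + 1)) ^ j), geom_sum_eq hne, hpow]
  simp

/-- The Laplacian of the `N`-cycle (divided by two) is diagonalized by the Fourier columns. -/
theorem fourierColumns_mul_diagonal_mul_conjTranspose {N : ℕ} [NeZero N] {ζ : ℂ}
    (h : IsPrimitiveRoot ζ N) (i j : Fin N) :
    (fourierColumns N ζ *
      diagonal (fun k : Fin (N - 1) => 1 - (ζ ^ ((k : ℕ) + 1) + (ζ ^ ((k : ℕ) + 1))⁻¹) / 2) *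
        (fourierColumns N ζ)ᴴ) i j =
      (if i = j then 1 else 0) -
        ((if i + 1 = j then 1 else 0) + (if i = j + 1 then 1 else 0)) / 2 := by
  have hζ := h.norm'_eq_one (NeZero.ne N)
  have hN : (N : ℂ) ≠ 0 := NeZero.ne _
  have hζ0 : ζ ≠ 0 := h.ne_zero (NeZero.ne N)
  have hroot : ∀ m : ℕ, (ζ ^ m) ^ N = 1 := fun m => by
    rw [← pow_mul, mul_comm, pow_mul, h.pow_eq_one, one_pow]
  have hsucc : ∀ i : Fin N, ζ * ζ ^ (i : ℕ) = ζ ^ ((i + 1 : Fin N) : ℕ) := by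
    intro i
    rw [← pow_succ', Fin.val_add, ← pow_mod_orderOf, ← h.eq_orderOf, Fin.val_one', Nat.add_mod_mod]
  rw [fourierColumns_mul_diagonal_mul_apply hζ]
  set z := ζ ^ (i : ℕ) * (ζ ^ (j : ℕ))⁻¹ with hz
  have hz1 : ζ * z = ζ ^ ((i + 1 : Fin N) : ℕ) * (ζ ^ (j : ℕ))⁻¹ := by
    rw [hz, ← mul_assoc, hsucc]
  have hz2 : ζ⁻¹ * z = ζ ^ (i : ℕ) * (ζ ^ ((j + 1 : Fin N) : ℕ))⁻¹ := by
    rw [hz, ← hsucc, mul_inv]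
    ring
  have hsplit : ∀ k : Fin (N - 1),
      (1 - (ζ ^ ((k : ℕ) + 1) + (ζ ^ ((k : ℕ) + 1))⁻¹) / 2) * z ^ ((k : ℕ) + 1) =
        z ^ ((k : ℕ) + 1) - ((ζ * z) ^ ((k : ℕ) + 1) + (ζ⁻¹ * z) ^ ((k : ℕ) + 1)) / 2 := by
    intro k
    rw [mul_pow, mul_pow, inv_pow]
    ring
  have hpow : ∀ a b : Fin N, (ζ ^ (a : ℕ) * (ζ ^ (b : ℕ))⁻¹) ^ N = 1 := fun a b => by
    rw [mul_pow, inv_pow, hroot, hroot, inv_one, mul_one]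
  simp only [hsplit]
  rw [sum_sub_distrib, ← sum_div, sum_add_distrib, hz1, hz2, hz,
    sum_pow_succ_of_pow_eq_one (NeZero.ne N) (hpow _ _),
    sum_pow_succ_of_pow_eq_one (NeZero.ne N) (hpow _ _),
    sum_pow_succ_of_pow_eq_one (NeZero.ne N) (hpow _ _)]
  simp only [h.pow_mul_inv_pow_eq_one_iff]
  have e : ∀ p : Prop, [Decidable p] → (if p then (N : ℂ) else 0) = N * (if p then 1 else 0) := by
    intro p _
    split_ifs <;> simp
  simp only [e]
  field_simp
  ring

/-- The `(k + 1)`-st eigenvalue of the cycle in terms of the primitive root `exp (2πi / N)`. -/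
theorem one_sub_half_pow_add_inv_pow_exp (N k : ℕ) :
    1 - (Complex.exp (2 * Real.pi * Complex.I / N) ^ (k + 1) +
        (Complex.exp (2 * Real.pi * Complex.I / N) ^ (k + 1))⁻¹) / 2 =
      ((1 - Real.cos (2 * Real.pi * ((k : ℝ) + 1) / N) : ℝ) : ℂ) := by
  rw [← Complex.exp_nat_mul, ← Complex.exp_neg]
  push_cast
  rw [Complex.cos]
  congr 4 <;> ring

/-- The eigenvalue bound for the tour visiting `0, 1, …, N - 1` in this order. -/
theorem sum_mul_le_sum_cyclic {N : ℕ} [NeZero N]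
    (D : Matrix (Fin N) (Fin N) ℝ) (hsym : D.IsSymm) (hdiag : ∀ i, D i i = 0)
    (P : Matrix (Fin N) (Fin N) ℝ)
    (hP : P = 1 - (N : ℝ)⁻¹ • Matrix.of (fun _ _ => (1 : ℝ)))
    (μ : Fin (N - 1) → ℝ) (hμa : Antitone μ)
    (hμ : (-(P * D * P)).charpoly = X * ∏ j, (X - C (μ j)))
    (c : Fin (N - 1) → ℝ) (hcm : Monotone c)
    (hc : ∃ g : Equiv.Perm (Fin (N - 1)), ∀ j,
      c j = 1 - Real.cos (2 * Real.pi * ((g j : ℕ) + 1) / N)) :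
    ∑ k, c k * μ k ≤ ∑ j, D j (j + 1) := by
  obtain ⟨g, hg⟩ := hc
  set ζ := Complex.exp (2 * Real.pi * Complex.I / N) with hζdef
  have hζ : IsPrimitiveRoot ζ N := Complex.isPrimitiveRoot_exp N (NeZero.ne N)
  set B := fourierColumns N ζ with hB
  set d : Fin (N - 1) → ℂ := fun k => 1 - (ζ ^ ((k : ℕ) + 1) + (ζ ^ ((k : ℕ) + 1))⁻¹) / 2 with hd
  have hdc : ∀ k, d (g k) = (c k : ℂ) := fun k => by
    rw [hg, hd, hζdef, ← one_sub_half_pow_add_inv_pow_exp]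
  set Dc : Matrix (Fin N) (Fin N) ℂ := D.map (algebraMap ℝ ℂ) with hDc
  have hBB : B * Bᴴ = P.map (algebraMap ℝ ℂ) := by
    rw [hB, fourierColumns_mul_conjTranspose hζ, hP]
    ext i j
    by_cases hij : i = j <;> simp [hij]
  have hPB : P.map (algebraMap ℝ ℂ) * B = B := by
    rw [← hBB, hB, fourierColumns_mul_conjTranspose hζ, Matrix.sub_mul, Matrix.one_mul,
      Matrix.smul_mul, sub_eq_self]
    ext j k
    simp [Matrix.mul_apply, sum_fourierColumns hζ]
  set A : Matrix (Fin (N - 1)) (Fin (N - 1)) ℂ := -(Bᴴ * Dc * B) with hA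
  have hAH : A.IsHermitian := by
    have hDH : Dcᴴ = Dc := by
      ext i j
      simp [hDc, hsym.apply i j]
    rw [Matrix.IsHermitian, hA]
    simp [Matrix.conjTranspose_mul, hDH, Matrix.mul_assoc]
  have hMc : (-(P * D * P)).map (algebraMap ℝ ℂ) =
      B * -(Bᴴ * Dc * P.map (algebraMap ℝ ℂ)) := by
    rw [Matrix.mul_neg, ← Matrix.mul_assoc, ← Matrix.mul_assoc, hBB, hDc, ← Matrix.map_mul,
      ← Matrix.map_mul]
    ext i j
    simp
  have hAchar : A.charpoly = ∏ j, (X - C (μ j : ℂ)) := by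
    have h1 := Matrix.charpoly_map (-(P * D * P)) (algebraMap ℝ ℂ)
    rw [hμ, hMc, Matrix.charpoly_mul_comm_of_le _ _ (by simp), Matrix.neg_mul, Matrix.mul_assoc,
      hPB, ← hA] at h1
    have h2 : Fintype.card (Fin N) - Fintype.card (Fin (N - 1)) = 1 := by
      have := NeZero.pos N
      simp only [Fintype.card_fin]
      omega
    rw [h2, pow_one, Polynomial.map_mul, Polynomial.map_X] at h1
    simpa [Polynomial.map_prod] using mul_left_cancel₀ X_ne_zero h1
  refine (hAH.sum_mul_le_sum_mul_diag (hcm.antivary hμa) hAchar g).trans_eq ?_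
  have htrace : ∑ k, A k k * d k = -∑ i, ∑ j, Dc i j * (B * diagonal d * Bᴴ) j i := by
    calc ∑ k, A k k * d k = (A * diagonal d).trace := by simp [Matrix.trace, Matrix.mul_diagonal]
      _ = -(Dc * (B * diagonal d * Bᴴ)).trace := by
        rw [hA, Matrix.neg_mul, Matrix.trace_neg, Matrix.mul_assoc, Matrix.mul_assoc,
          Matrix.trace_mul_comm]
        simp only [Matrix.mul_assoc]
      _ = _ := by simp [Matrix.trace, Matrix.mul_apply]
  have hsum : ∑ k, A k k * d k = ((∑ j, D j (j + 1) : ℝ) : ℂ) := by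
    have hsucc : ∑ i, ∑ j, Dc i j * (if i = j + 1 then 1 else 0) = ∑ j, Dc j (j + 1) := by
      rw [Finset.sum_comm]
      simp [hDc, hsym.apply]
    have hpred : ∑ i, ∑ j, Dc i j * (if j = i + 1 then 1 else 0) = ∑ j, Dc j (j + 1) := by
      simp
    have hzero : ∑ i, ∑ j, Dc i j * (if j = i then 1 else 0) = 0 := by
      simp [hDc, hdiag]
    rw [htrace, hB, hd]
    simp only [fourierColumns_mul_diagonal_mul_conjTranspose hζ, mul_sub, mul_div_assoc', mul_add,
      sum_sub_distrib, ← sum_div, sum_add_distrib]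
    rw [show ∑ i, ∑ j, Dc i j * (if j + 1 = i then 1 else 0) = ∑ j, Dc j (j + 1) by
      simpa only [eq_comm] using hsucc, hpred, hzero]
    simp [hDc]
  have hre := congrArg Complex.re hsum
  rw [Complex.ofReal_re] at hre
  rw [← hre, ← Equiv.sum_comp g fun k => A k k * d k, Complex.re_sum]
  refine sum_congr rfl fun k _ => ?_
  rw [hdc, Complex.re_mul_ofReal, mul_comm]

/-- The main eigenvalue lower bound on the symmetric TSP: every tour length is at least
`∑ k, c k * μ k`, hence so is the optimum. -/
theorem tsp_eigenvalue_lower_bound {N : ℕ} [NeZero N] (hN : 3 ≤ N)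
    (D : Matrix (Fin N) (Fin N) ℝ) (hsym : D.IsSymm) (hdiag : ∀ i, D i i = 0)
    (P : Matrix (Fin N) (Fin N) ℝ)
    (hP : P = 1 - (N : ℝ)⁻¹ • Matrix.of (fun _ _ => (1 : ℝ)))
    (μ : Fin (N - 1) → ℝ) (hμa : Antitone μ)
    (hμ : (-(P * D * P)).charpoly =
      Polynomial.X * ∏ j, (Polynomial.X - Polynomial.C (μ j)))
    (c : Fin (N - 1) → ℝ) (hcm : Monotone c)
    (hc : ∃ g : Equiv.Perm (Fin (N - 1)), ∀ j,
      c j = 1 - Real.cos (2 * Real.pi * ((g j : ℕ) + 1) / N)) :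
    ∀ σ : Equiv.Perm (Fin N), ∑ k, c k * μ k ≤ ∑ j, D (σ j) (σ (j + 1)) := by
  intro σ
  have hPσ : P.submatrix σ σ = P := by
    rw [hP]
    ext i j
    simp [Matrix.one_apply]
  have hM : (-(P * D.submatrix σ σ * P)) = Matrix.reindex σ.symm σ.symm (-(P * D * P)) := by
    conv_lhs => rw [← hPσ]
    rw [Matrix.submatrix_mul_equiv, Matrix.submatrix_mul_equiv]
    rfl
  refine sum_mul_le_sum_cyclic (D.submatrix σ σ) (hsym.submatrix σ) (fun i => hdiag (σ i)) P hP
    μ hμa ?_ c hcm hc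
  rw [hM, Matrix.charpoly_reindex, hμ]
end
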